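/- Let t¹ ≤ t² be thresholds and μ a real with |μ| ≤ t¹. Then for every real x, (x − μ)(η_H(x, t²) − μ) ≤ (x − μ)(η_H(x, t¹) − μ), where η_H(x,t) = x·1{|x| ≥ t}. -/

import Mathlib

noncomputable def etaH (x t : ℝ) : ℝ := if t ≤ |x| then x else 0

theorem stmt15 (t1 t2 μ : ℝ) (h12 : t1 ≤ t2) (hμ : |μ| ≤ t1) :
    ∀ x : ℝ, (x - μ) * (etaH x t2 - μ) ≤ (x - μ) * (etaH x t1 - μ) := by
  intro x
  unfold etaH
  split_ifs with h2 h1 h1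
  · exact le_rfl
  · exact absurd (h12.trans h2) h1
  · have hμx : μ * x ≤ x * x :=
      calc μ * x ≤ |μ * x| := le_abs_self _
        _ = |μ| * |x| := abs_mul μ x
        _ ≤ |x| * |x| := mul_le_mul_of_nonneg_right (hμ.trans h1) (abs_nonneg x)
        _ = x * x := abs_mul_abs_self x
    linarith
  · exact le_rfl
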